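/- Let F be a field of characteristic 2 and let b_1,…,b_r ∈ F be 2-independent. Then (Σ_{i=1}^r db_i ∧ Ω_F^{n-1}) ∩ ν_n(F) = ⟨dx/x : x ∈ F²(b_1,…,b_r)^*⟩ ∧ ν_{n-1}(F), i.e. this intersection is additively generated by the forms (dx/x) ∧ (dy_2/y_2) ∧ … ∧ (dy_n/y_n) with x ∈ F²(b_1,…,b_r)^* and y_2,…,y_n ∈ F^*. -/

import Mathlib

noncomputable section

/-- The full algebra of absolute differential forms of a field `F`:
the exterior algebra of the `F`-module of absolute Kähler differentials `Ω[F⁄ℤ]`. -/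
abbrev DF (F : Type*) [Field F] : Type _ :=
  ExteriorAlgebra F (KaehlerDifferential ℤ F)

/-- `Ω_F^n`, the space of differential `n`-forms, as a submodule of `DF F`. -/
def omegaPow (F : Type*) [Field F] (n : ℕ) : Submodule F (DF F) :=
  LinearMap.range (ExteriorAlgebra.ι F :
    KaehlerDifferential ℤ F →ₗ[F] DF F) ^ n

/-- `Ω_F^{n-1}`, with the convention `Ω_F^{-1} = 0`. -/
def omegaPred (F : Type*) [Field F] : ℕ → Submodule F (DF F)
  | 0 => ⊥
  | n + 1 => omegaPow F n

/-- The exact 1-form `d a` of an element `a ∈ F`. -/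
def dForm (F : Type*) [Field F] (a : F) : DF F :=
  ExteriorAlgebra.ι F (KaehlerDifferential.D ℤ F a)

/-- The logarithmic 1-form `da/a` of an element `a ∈ F`. -/
def dLog (F : Type*) [Field F] (a : F) : DF F :=
  ExteriorAlgebra.ι F (a⁻¹ • KaehlerDifferential.D ℤ F a)

/-- The logarithmic `n`-form `(dx₁/x₁) ∧ … ∧ (dxₙ/xₙ)`. -/
def logForm (F : Type*) [Field F] {n : ℕ} (x : Fin n → F) : DF F :=
  (List.ofFn fun i => dLog F (x i)).prod

/-- The exterior derivative `d` together with the (`p`-basis dependent) additive map `s_p`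
on the differential forms of a field `F` of characteristic `p`. -/
structure DiffStr (p : ℕ) (F : Type*) [Field F] where
  d : DF F →+ DF F
  sp : DF F →+ DF F
  d_grade : ∀ n : ℕ, ∀ ω ∈ omegaPow F n, d ω ∈ omegaPow F (n + 1)
  d_d : ∀ ω : DF F, d (d ω) = 0
  d_one : d 1 = 0
  d_smul : ∀ (a : F) (ω : DF F), d (a • ω) = dForm F a * ω + a • d ω
  sp_grade : ∀ n : ℕ, ∀ ω ∈ omegaPow F n, sp ω ∈ omegaPow F n
  sp_log : ∀ (n : ℕ) (a : F) (x : Fin n → F),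
      ∃ η ∈ omegaPred F n, sp (a • logForm F x) = a ^ p • logForm F x + d η

/-- The Artin–Schreier map `℘ = s_p − id` on differential forms. -/
def asMap {p : ℕ} {F : Type*} [Field F] (S : DiffStr p F) : DF F →+ DF F :=
  S.sp - AddMonoidHom.id (DF F)

/-- The subgroup `℘Ω_F^n + dΩ_F^{n-1}` of `Ω_F^n`; the group `H_p^{n+1}(F)` is the quotient
of `Ω_F^n` by this subgroup. -/
def hRel {p : ℕ} {F : Type*} [Field F] (S : DiffStr p F) (n : ℕ) : AddSubgroup (DF F) :=
  ((omegaPow F n).toAddSubgroup.map (asMap S)) ⊔ ((omegaPred F n).toAddSubgroup.map S.d)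

/-- The `t`-th iterate `v ↦ v^{[p^t]}` of the map `s_p`. -/
def spIter {p : ℕ} {F : Type*} [Field F] (S : DiffStr p F) (t : ℕ) : DF F → DF F :=
  (fun x => S.sp x)^[t]

/-- `ν_n(F) = ker(℘ : Ω_F^n → Ω_F^n/dΩ_F^{n-1})`. -/
def nuSet {p : ℕ} {F : Type*} [Field F] (S : DiffStr p F) (n : ℕ) : Set (DF F) :=
  { η | η ∈ omegaPow F n ∧ ∃ z ∈ omegaPred F n, S.sp η - η = S.d z }

/-- Restriction of differential forms along a field extension `E/F`. -/
structure DiffRes (p : ℕ) (F E : Type*) [Field F] [Field E] [Algebra F E]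
    (SF : DiffStr p F) (SE : DiffStr p E) where
  res : DF F →+ DF E
  res_one : res 1 = 1
  res_mul : ∀ x y : DF F, res (x * y) = res x * res y
  res_smul : ∀ (a : F) (ω : DF F), res (a • ω) = algebraMap F E a • res ω
  res_dForm : ∀ a : F, res (dForm F a) = dForm E (algebraMap F E a)
  res_grade : ∀ n : ℕ, ∀ ω ∈ omegaPow F n, res ω ∈ omegaPow E n
  res_d : ∀ ω : DF F, res (SF.d ω) = SE.d (res ω)

/-- `2`-independence of `b₁,…,b_r ∈ F`: `[F²(b₁,…,b_r) : F²] = 2^r`, expressed as the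
linear independence over `F²` of the `2^r` monomials `∏ bᵢ^{eᵢ}`, `0 ≤ eᵢ < 2`. -/
def TwoIndep {F : Type*} [Field F] {r : ℕ} (b : Fin r → F) : Prop :=
  ∀ c : (Fin r → Fin 2) → F,
    (∑ e : Fin r → Fin 2, c e ^ 2 * ∏ i, b i ^ (e i : ℕ)) = 0 → ∀ e, c e = 0

/-- The subfield `F²(b₁,…,b_r)` of `F` generated by the squares and `b₁,…,b_r`. -/
def sqSubfield {F : Type*} [Field F] {r : ℕ} (b : Fin r → F) : Subfield F :=
  Subfield.closure (Set.range (fun y : F => y ^ 2) ∪ Set.range b)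

set_option linter.unusedSectionVars false

section FieldPart

variable {F : Type*} [Field F] [CharP F 2]

/-- `M + M x` for a subfield `M` containing all squares. -/
def extTwo (M : Subfield F) (hM : ∀ y : F, y ^ 2 ∈ M) (x : F) : Subfield F where
  carrier := {z | ∃ p ∈ M, ∃ q ∈ M, z = p + q * x}
  zero_mem' := ⟨0, M.zero_mem, 0, M.zero_mem, by simp⟩
  one_mem' := ⟨1, M.one_mem, 0, M.zero_mem, by simp⟩
  add_mem' := by
    rintro _ _ ⟨p, hp, q, hq, rfl⟩ ⟨p', hp', q', hq', rfl⟩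
    exact ⟨p + p', M.add_mem hp hp', q + q', M.add_mem hq hq', by ring⟩
  neg_mem' := by
    rintro _ ⟨p, hp, q, hq, rfl⟩
    exact ⟨-p, M.neg_mem hp, -q, M.neg_mem hq, by ring⟩
  mul_mem' := by
    rintro _ _ ⟨p, hp, q, hq, rfl⟩ ⟨p', hp', q', hq', rfl⟩
    exact ⟨p * p' + q * q' * x ^ 2,
      M.add_mem (M.mul_mem hp hp') (M.mul_mem (M.mul_mem hq hq') (hM x)),
      p * q' + q * p', M.add_mem (M.mul_mem hp hq') (M.mul_mem hq hp'), by ring⟩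
  inv_mem' := by
    rintro _ ⟨p, hp, q, hq, rfl⟩
    refine ⟨p * ((p + q * x)⁻¹) ^ 2, M.mul_mem hp (hM _), q * ((p + q * x)⁻¹) ^ 2,
      M.mul_mem hq (hM _), ?_⟩
    by_cases h : p + q * x = 0
    · simp [h]
    · have : p * (p + q * x)⁻¹ ^ 2 + q * (p + q * x)⁻¹ ^ 2 * x
        = (p + q * x) * (p + q * x)⁻¹ ^ 2 := by ring
      rw [this, pow_two, ← mul_assoc, mul_inv_cancel₀ h, one_mul]

lemma le_extTwo (M : Subfield F) (hM : ∀ y : F, y ^ 2 ∈ M) (x : F) : M ≤ extTwo M hM x :=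
  fun p hp => ⟨p, hp, 0, M.zero_mem, by simp⟩

lemma mem_extTwo (M : Subfield F) (hM : ∀ y : F, y ^ 2 ∈ M) (x : F) : x ∈ extTwo M hM x :=
  ⟨0, M.zero_mem, 1, M.one_mem, by simp⟩

lemma exists_derivation (K : Subfield F) (hK : ∀ y : F, y ^ 2 ∈ K) (a : F) (ha : a ∉ K) :
    ∃ X : Derivation ℤ F F, (∀ x ∈ K, X x = 0) ∧ X a ≠ 0 := by
  obtain ⟨M, hKM, hmax⟩ := zorn_le_nonempty₀ {M : Subfield F | K ≤ M ∧ a ∉ M} (by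
    intro c hc hch y hy
    refine ⟨sSup c, ⟨(hc hy).1.trans (le_sSup hy), ?_⟩, fun z hz => le_sSup hz⟩
    rw [Subfield.mem_sSup_of_directedOn ⟨y, hy⟩ hch.directedOn]
    rintro ⟨z, hz, haz⟩
    exact (hc hz).2 haz) K ⟨le_rfl, ha⟩
  have haM : a ∉ M := hmax.prop.2
  have hM : ∀ y : F, y ^ 2 ∈ M := fun y => hKM (hK y)
  have h2 : (2 : F) = 0 := CharTwo.two_eq_zero
  have hex : ∀ x : F, ∃ p ∈ M, ∃ q ∈ M, x = p + q * a := by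
    intro x
    by_cases hx : x ∈ M
    · exact ⟨x, hx, 0, M.zero_mem, by simp⟩
    by_contra hne
    have hax : a ∉ extTwo M hM x := by
      rintro ⟨p, hp, q, hq, h⟩
      have hq0 : q ≠ 0 := by
        rintro rfl
        apply haM
        rw [h]; simpa using hp
      apply hne
      refine ⟨-(p / q), M.neg_mem (M.div_mem hp hq), q⁻¹, M.inv_mem hq, ?_⟩
      rw [h]; field_simp; ring
    have := hmax.le_of_ge (y := extTwo M hM x) ⟨hKM.trans (le_extTwo M hM x), hax⟩
      (le_extTwo M hM x)
    exact hx (this (mem_extTwo M hM x))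
  choose p hp q hq hpq using hex
  have huniq : ∀ x p' q', p' ∈ M → q' ∈ M → x = p' + q' * a → q x = q' := by
    intro x p' q' hp' hq' h
    by_contra hne
    apply haM
    have h1 : (q x - q') * a = p' - p x := by
      have := hpq x
      linear_combination h - this
    have h3 : q x - q' ≠ 0 := sub_ne_zero.2 hne
    have : a = (p' - p x) / (q x - q') := by field_simp; linear_combination h1
    rw [this]
    exact M.div_mem (M.sub_mem hp' (hp x)) (M.sub_mem (hq x) hq')
  let L : F →+ F := AddMonoidHom.mk' q (fun x y => by
    apply huniq (x + y) (p x + p y) (q x + q y) (M.add_mem (hp x) (hp y)) (M.add_mem (hq x) (hq y))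
    linear_combination hpq x + hpq y)
  refine ⟨Derivation.mk' L.toIntLinearMap ?_, ?_, ?_⟩
  · intro x y
    show q (x * y) = x * q y + y * q x
    rw [huniq (x * y) (p x * p y + q x * q y * a ^ 2) (p x * q y + p y * q x)
      (M.add_mem (M.mul_mem (hp x) (hp y)) (M.mul_mem (M.mul_mem (hq x) (hq y)) (hM a)))
      (M.add_mem (M.mul_mem (hp x) (hq y)) (M.mul_mem (hp y) (hq x)))
      (by conv_lhs => rw [hpq x, hpq y]
          ring)]
    linear_combination (-q y) * hpq x + (- q x) * hpq y - q x * q y * a * h2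
  · intro x hx
    exact huniq x x 0 (hKM hx) M.zero_mem (by simp)
  · have : q a = 1 := huniq a 0 1 M.zero_mem M.one_mem (by simp)
    show q a ≠ 0
    rw [this]; exact one_ne_zero

lemma exists_subfield_expand {r : ℕ} (b : Fin r → F) (s : Finset (Fin r)) :
    ∃ M : Subfield F, (∀ y : F, y ^ 2 ∈ M) ∧ (∀ i ∈ s, b i ∈ M) ∧
      ∀ x ∈ M, ∃ c : Finset (Fin r) → F, x = ∑ t ∈ s.powerset, c t ^ 2 * ∏ i ∈ t, b i := by
  classical
  induction s using Finset.induction_on with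
  | empty =>
    refine ⟨(frobenius F 2).fieldRange, fun y => ⟨y, rfl⟩, by simp, ?_⟩
    rintro _ ⟨y, rfl⟩
    exact ⟨fun _ => y, by simp [frobenius_def]⟩
  | insert i s hi ih =>
    obtain ⟨M, hM, hb, hx⟩ := ih
    refine ⟨extTwo M hM (b i), fun y => le_extTwo M hM _ (hM y), ?_, ?_⟩
    · intro j hj
      rcases Finset.mem_insert.1 hj with rfl | hj
      · exact mem_extTwo M hM _
      · exact le_extTwo M hM _ (hb j hj)
    · rintro _ ⟨p, hp, q, hq, rfl⟩
      obtain ⟨c, hc⟩ := hx p hp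
      obtain ⟨c', hc'⟩ := hx q hq
      refine ⟨fun t => if i ∈ t then c' (t.erase i) else c t, ?_⟩
      rw [Finset.sum_powerset_insert hi]
      congr 1
      · rw [hc]
        refine Finset.sum_congr rfl fun t ht => ?_
        beta_reduce
        rw [if_neg fun h => hi (Finset.mem_powerset.1 ht h)]
      · rw [hc', Finset.sum_mul]
        refine Finset.sum_congr rfl fun t ht => ?_
        have hit : i ∉ t := fun h => hi (Finset.mem_powerset.1 ht h)
        beta_reduce
        rw [if_pos (Finset.mem_insert_self i t), Finset.erase_insert hit, Finset.prod_insert hit]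
        ring

lemma twoIndep_linearIndependent {r : ℕ} (b : Fin r → F) (hb : TwoIndep b) :
    LinearIndependent F (fun i => KaehlerDifferential.D ℤ F (b i)) := by
  classical
  rw [linearIndependent_iff_notMem_span]
  intro i hi
  obtain ⟨M, hM, hbM, hx⟩ := exists_subfield_expand b (Finset.univ.erase i)
  have hiM : b i ∉ M := by
    intro h
    obtain ⟨c, hc⟩ := hx _ h
    let T : (Fin r → Fin 2) → Finset (Fin r) := fun e => Finset.univ.filter (fun j => e j = 1)
    let d : Finset (Fin r) → F := fun t => if t = {i} then 1 else if i ∈ t then 0 else c t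
    have h1 : (∑ e : Fin r → Fin 2, (d (T e)) ^ 2 * ∏ j, b j ^ (e j : ℕ)) = 0 := by
      have h3 : (∑ e : Fin r → Fin 2, (d (T e)) ^ 2 * ∏ j, b j ^ (e j : ℕ))
          = ∑ t : Finset (Fin r), d t ^ 2 * ∏ j ∈ t, b j := by
        refine Finset.sum_bij' (fun e _ => T e) (fun t _ => fun j => if j ∈ t then 1 else 0)
          (by simp) (by simp) ?_ ?_ ?_
        · intro e _
          funext j
          have := Fin.exists_fin_two.1 ⟨e j, rfl⟩
          by_cases hj : e j = 1
          · simp [T, hj]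
          · have : e j = 0 := by omega
            simp [T, this]
        · intro t _
          ext j
          simp [T]
        · intro e _
          congr 1
          rw [Finset.prod_filter]
          refine Finset.prod_congr rfl fun j _ => ?_
          by_cases hj : e j = 1
          · simp [hj]
          · have : e j = 0 := by omega
            simp [this]
      rw [h3]
      have h4 : ∀ t : Finset (Fin r), d t ^ 2 * ∏ j ∈ t, b j =
          (if t = {i} then b i else 0) +
          (if t ∈ (Finset.univ.erase i).powerset then c t ^ 2 * ∏ j ∈ t, b j else 0) := by
        intro t
        by_cases ht : t = {i}
        · subst ht
          simp [d, Finset.subset_erase]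
        · by_cases hit : i ∈ t
          · simp [d, ht, hit, Finset.subset_erase]
          · simp [d, ht, hit, Finset.subset_erase]
      rw [Finset.sum_congr rfl fun t _ => h4 t, Finset.sum_add_distrib, Finset.sum_ite_eq',
        if_pos (Finset.mem_univ _), Finset.sum_ite_mem, Finset.univ_inter, ← hc]
      exact CharTwo.add_self_eq_zero _
    have h2 := hb _ h1 (fun j => if j = i then 1 else 0)
    have h5 : T (fun j => if j = i then 1 else 0) = {i} := by
      ext j; simp [T]
    simp [h5, d] at h2
  obtain ⟨X, hX, hXi⟩ := exists_derivation M hM (b i) hiM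
  apply hXi
  have : ∀ w ∈ Submodule.span F ((fun i => KaehlerDifferential.D ℤ F (b i)) '' (Set.univ \ {i})),
      X.liftKaehlerDifferential w = 0 := by
    intro w hw
    induction hw using Submodule.span_induction with
    | mem x h =>
      obtain ⟨j, hj, rfl⟩ := h
      have : b j ∈ M := hbM j (by simpa using hj)
      simpa using hX _ this
    | zero => simp
    | add x y _ _ hx hy => rw [map_add, hx, hy, add_zero]
    | smul c x _ hx => rw [map_smul, hx, smul_zero]
  simpa using this _ hi

lemma exists_good_basis {r : ℕ} (b : Fin r → F) (hb : TwoIndep b) :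
    ∃ (J : Set F) (B : Module.Basis J F (KaehlerDifferential ℤ F)),
      (∀ j : J, (j : F) ≠ 0 ∧ B j = (j : F)⁻¹ • KaehlerDifferential.D ℤ F (j : F)) ∧
      Set.range b ⊆ J ∧
      (∀ u : F, (∀ j : J, (j : F) ∉ Set.range b → B.repr (KaehlerDifferential.D ℤ F u) j = 0) →
        u ∈ sqSubfield b) := by
  have hli := twoIndep_linearIndependent b hb
  have h0 : LinearIndepOn F (fun x : F => KaehlerDifferential.D ℤ F x) (Set.range b) :=
    (linearIndepOn_range_iff (hli.injective.of_comp (f := KaehlerDifferential.D ℤ F)) _).2 hli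
  let J := h0.extend (Set.subset_univ _)
  have hJ : LinearIndepOn F (fun x : F => KaehlerDifferential.D ℤ F x) J :=
    h0.linearIndepOn_extend _
  have hspan : ⊤ ≤ Submodule.span F (Set.range fun j : J => KaehlerDifferential.D ℤ F (j : F)) := by
    have := h0.span_image_extend_eq_span_image (Set.subset_univ _)
    rw [Set.image_univ, KaehlerDifferential.span_range_derivation] at this
    rw [← this, Set.image_eq_range]
  let B0 : Module.Basis J F (KaehlerDifferential ℤ F) := Module.Basis.mk hJ hspan
  have hj0 : ∀ j : J, (j : F) ≠ 0 := by
    intro j hj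
    have := LinearIndependent.ne_zero j hJ
    simp [hj] at this
  have hunit : ∀ j : J, IsUnit ((j : F)⁻¹) := fun j => (isUnit_iff_ne_zero.2 (inv_ne_zero (hj0 j)))
  let B := B0.isUnitSMul hunit
  have hB : ∀ j : J, B j = (j : F)⁻¹ • KaehlerDifferential.D ℤ F (j : F) := by
    intro j
    rw [Module.Basis.isUnitSMul_apply]
    congr 1
    exact Module.Basis.mk_apply hJ hspan j
  refine ⟨J, B, fun j => ⟨hj0 j, hB j⟩, h0.subset_extend _, ?_⟩
  intro u hu
  by_contra hne
  obtain ⟨X, hX, hXu⟩ := exists_derivation (sqSubfield b)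
    (fun y => Subfield.subset_closure (Or.inl ⟨y, rfl⟩)) u hne
  apply hXu
  have h1 := congrArg X.liftKaehlerDifferential
    (B.linearCombination_repr (KaehlerDifferential.D ℤ F u))
  rw [Derivation.liftKaehlerDifferential_comp_D] at h1
  rw [← h1, Finsupp.linearCombination_apply, Finsupp.sum, map_sum]
  refine Finset.sum_eq_zero fun j _ => ?_
  by_cases hj : (j : F) ∈ Set.range b
  · have : X (j : F) = 0 := hX _ (Subfield.subset_closure (Or.inr hj))
    rw [map_smul, hB, map_smul, Derivation.liftKaehlerDifferential_comp_D, this]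
    simp
  · rw [hu j hj]; simp

end FieldPart

section DerPart

variable {F : Type*} [Field F] [CharP F 2] {I : Type*}

/-- The coordinate derivations attached to a basis of the Kähler differentials. -/
def pd (B : Module.Basis I F (KaehlerDifferential ℤ F)) (i : I) : Derivation ℤ F F :=
  (B.coord i).compDer (KaehlerDifferential.D ℤ F)

lemma pd_apply (B : Module.Basis I F (KaehlerDifferential ℤ F)) (i : I) (a : F) :
    pd B i a = B.repr (KaehlerDifferential.D ℤ F a) i := rfl

lemma der_sq (X : Derivation ℤ F F) (a : F) : X (a ^ 2) = 0 := by
  rw [pow_two, X.leibniz]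
  exact CharTwo.add_self_eq_zero _

lemma der_sq_mul (X : Derivation ℤ F F) (a c : F) : X (a ^ 2 * c) = a ^ 2 * X c := by
  rw [X.leibniz, der_sq]
  simp

/-- A top-variable sum. -/
def TopSum (B : Module.Basis I F (KaehlerDifferential ℤ F)) [LinearOrder I] (α : Finset I) (c : F) : Prop :=
  ∃ f : I → F, c = ∑ i ∈ α, f i ∧ ∀ i ∈ α, pd B i (f i) = f i ∧ ∀ j, i < j → pd B j (f i) = 0

variable (B : Module.Basis I F (KaehlerDifferential ℤ F)) (β : I → F)

lemma der_ext_zero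
    (hB : ∀ j, β j ≠ 0 ∧ B j = (β j)⁻¹ • KaehlerDifferential.D ℤ F (β j))
    (X : Derivation ℤ F F) (hX : ∀ j, X (β j) = 0) (a : F) : X a = 0 := by
  have h : X.liftKaehlerDifferential = 0 := by
    apply B.ext
    intro j
    rw [(hB j).2, map_smul, Derivation.liftKaehlerDifferential_comp_D, hX]
    simp
  rw [← Derivation.liftKaehlerDifferential_comp_D, h]
  rfl

lemma pd_beta
    (hB : ∀ j, β j ≠ 0 ∧ B j = (β j)⁻¹ • KaehlerDifferential.D ℤ F (β j))
    (i j : I) [DecidableEq I] : pd B i (β j) = if i = j then β j else 0 := by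
  have h : KaehlerDifferential.D ℤ F (β j) = β j • B j := by
    rw [(hB j).2, smul_smul, mul_inv_cancel₀ (hB j).1, one_smul]
  rw [pd_apply, h, map_smul, Module.Basis.repr_self]
  by_cases hij : i = j
  · subst hij; simp
  · simp [hij, Finsupp.single_eq_of_ne hij]

lemma pd_comm
    (hB : ∀ j, β j ≠ 0 ∧ B j = (β j)⁻¹ • KaehlerDifferential.D ℤ F (β j))
    (i j : I) (a : F) : pd B i (pd B j a) = pd B j (pd B i a) := by
  classical
  have := der_ext_zero B β hB ⁅pd B i, pd B j⁆ (by
    intro k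
    rw [Derivation.commutator_apply, pd_beta B β hB, pd_beta B β hB]
    by_cases h1 : i = k <;> by_cases h2 : j = k <;> simp [h1, h2, pd_beta B β hB]) a
  rw [Derivation.commutator_apply] at this
  exact sub_eq_zero.1 this

lemma pd_idem
    (hB : ∀ j, β j ≠ 0 ∧ B j = (β j)⁻¹ • KaehlerDifferential.D ℤ F (β j))
    (i : I) (a : F) : pd B i (pd B i a) = pd B i a := by
  classical
  let X : Derivation ℤ F F := Derivation.mk'
    ((pd B i).toLinearMap.comp (pd B i).toLinearMap - (pd B i).toLinearMap) (by
      intro x y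
      have h2 : (2 : F) = 0 := CharTwo.two_eq_zero
      simp only [LinearMap.sub_apply, LinearMap.comp_apply, Derivation.coeFn_coe,
        Derivation.leibniz, map_add, smul_eq_mul]
      linear_combination (pd B i x * pd B i y) * h2)
  have hX : ∀ x, X x = pd B i (pd B i x) - pd B i x := fun x => rfl
  have := der_ext_zero B β hB X (by
    intro k
    rw [hX, pd_beta B β hB]
    by_cases h1 : i = k <;> simp [h1, pd_beta B β hB]) a
  rw [hX] at this
  exact sub_eq_zero.1 this

/-- A sum of elements in the images of the projections `pd j`, `j ∈ T`, which is killed by all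
these projections, vanishes. -/
lemma sum_pd_eq_zero
    (hB : ∀ j, β j ≠ 0 ∧ B j = (β j)⁻¹ • KaehlerDifferential.D ℤ F (β j))
    (T : Finset I) : ∀ (x : F) (y : I → F), x = ∑ j ∈ T, pd B j (y j) →
    (∀ j ∈ T, pd B j x = 0) → x = 0 := by
  classical
  induction T using Finset.induction_on with
  | empty => intro x y h _; simpa using h
  | insert m T hm ih =>
    intro x y h hx
    refine ih x (fun j => y j - pd B m (y j)) ?_ fun j hj => hx j (Finset.mem_insert_of_mem hj)
    have h1 : x - pd B m x = x := by rw [hx m (Finset.mem_insert_self _ _), sub_zero]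
    rw [← h1, h, Finset.sum_insert hm, map_add, map_sum, pd_idem B β hB]
    simp only [map_sub, Finset.sum_sub_distrib]
    rw [Finset.sum_congr rfl fun j _ => pd_comm B β hB m j (y j)]
    ring

/-- Decomposition of an element according to its top variable. -/
lemma exists_decomp
    (hB : ∀ j, β j ≠ 0 ∧ B j = (β j)⁻¹ • KaehlerDifferential.D ℤ F (β j))
    [LinearOrder I] (T : Finset I) : ∀ c : F, (∀ i, i ∉ T → pd B i c = 0) →
    ∃ (c0 : F) (f : I → F), c = c0 + ∑ i ∈ T, f i ∧ (∀ i, pd B i c0 = 0) ∧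
      ∀ i ∈ T, pd B i (f i) = f i ∧ ∀ j, i < j → pd B j (f i) = 0 := by
  induction T using Finset.induction_on_max with
  | empty => intro c hc; exact ⟨c, 0, by simp, fun i => hc i (by simp), by simp⟩
  | insert m T hm ih =>
    intro c hc
    have hmT : m ∉ T := fun h => lt_irrefl _ (hm m h)
    obtain ⟨c0, f, h1, h2, h3⟩ := ih (c - pd B m c) (by
      intro i hi
      rw [map_sub]
      by_cases him : i = m
      · subst him; rw [pd_idem B β hB, sub_self]
      · rw [pd_comm B β hB, hc i (by simp [him, hi])]; simp)
    refine ⟨c0, fun i => if i = m then pd B m c else f i, ?_, h2, ?_⟩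
    · rw [Finset.sum_insert hmT, if_pos rfl, Finset.sum_congr rfl (g := f)]
      · linear_combination h1
      · intro i hi
        rw [if_neg (fun h : i = m => hmT (h ▸ hi))]
    · intro i hi
      rcases Finset.mem_insert.1 hi with rfl | hi
      · simp only [if_true]
        refine ⟨pd_idem B β hB _ _, fun j hj => ?_⟩
        rw [pd_comm B β hB, hc j, map_zero]
        intro hjT
        rcases Finset.mem_insert.1 hjT with h | h
        · exact hj.ne' h
        · exact lt_asymm hj (hm j h)
      · simp only [if_neg (fun h : i = m => hmT (h ▸ hi))]
        exact h3 i hi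

end DerPart

section FormPart

variable {F : Type*} [Field F] [CharP F 2]

lemma df_neg (x : DF F) : -x = x := by
  have : (-1 : F) • x = (1 : F) • x := by rw [CharTwo.neg_eq]
  simpa using this

lemma iota_comm (x y : KaehlerDifferential ℤ F) :
    ExteriorAlgebra.ι F x * ExteriorAlgebra.ι F y
      = (ExteriorAlgebra.ι F y * ExteriorAlgebra.ι F x : DF F) := by
  have := ExteriorAlgebra.ι_add_mul_swap (R := F) x y
  rw [eq_neg_of_add_eq_zero_left this, df_neg]

lemma logForm_cons {n : ℕ} (x : F) (y : Fin n → F) :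
    logForm F (Fin.cons x y : Fin (n + 1) → F) = dLog F x * logForm F y := by
  simp [logForm, List.ofFn_succ]

lemma logForm_zero (y : Fin 0 → F) : logForm F y = 1 := by
  simp [logForm]

lemma logForm_mem {n : ℕ} (y : Fin n → F) : logForm F y ∈ omegaPow F n := by
  induction n with
  | zero => simp [logForm_zero, omegaPow, Submodule.mem_one]
  | succ n ih =>
    rw [← Fin.cons_self_tail y, logForm_cons, omegaPow, pow_succ']
    exact Submodule.mul_mem_mul ⟨_, rfl⟩ (ih _)

lemma dLog_eq (x : F) : dLog F x = x⁻¹ • dForm F x := by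
  rw [dLog, dForm, map_smul]

section S
variable (S : DiffStr 2 F)

lemma d_dForm_mul (x : F) (w : DF F) (hw : S.d w = 0) : S.d (dForm F x * w) = 0 := by
  have h := S.d_smul x w
  rw [hw, smul_zero, add_zero] at h
  rw [← h, S.d_d]

lemma d_dLog_mul (x : F) (w : DF F) (hw : S.d w = 0) : S.d (dLog F x * w) = 0 := by
  rw [dLog_eq, smul_mul_assoc, S.d_smul, d_dForm_mul S x w hw, smul_zero, add_zero, ← mul_assoc]
  have : dForm F (x⁻¹) * dForm F x = 0 := by
    have h1 : KaehlerDifferential.D ℤ F x⁻¹ = (-(x⁻¹ ^ 2)) • KaehlerDifferential.D ℤ F x := by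
      rw [Derivation.leibniz_inv]
    rw [dForm, dForm, h1, map_smul, smul_mul_assoc, ExteriorAlgebra.ι_sq_zero, smul_zero]
  rw [this, zero_mul]

lemma d_logForm {n : ℕ} (y : Fin n → F) : S.d (logForm F y) = 0 := by
  induction n with
  | zero => rw [logForm_zero, S.d_one]
  | succ n ih =>
    rw [← Fin.cons_self_tail y, logForm_cons]
    exact d_dLog_mul S _ _ (ih _)

end S

variable {I : Type*} [LinearOrder I] (B : Module.Basis I F (KaehlerDifferential ℤ F))

lemma iota_mul_E (i : I) (s : Finset I) :
    ExteriorAlgebra.ι F (B i) * B.ExteriorAlgebra s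
      = if i ∈ s then 0 else B.ExteriorAlgebra (insert i s) := by
  have h1 : (ExteriorAlgebra.ι F (B i) : DF F) = B.ExteriorAlgebra {i} := by
    rw [ExteriorAlgebra.basis_apply_ofCard B (n := 1) (Finset.card_singleton i)]
    simp [ExteriorAlgebra.ιMulti_family, ExteriorAlgebra.ιMulti_apply,
      Set.powersetCard.ofFinEmbEquiv_symm_apply]
  have h2 := ExteriorAlgebra.basis_mul_of_not_disjoint B
    (Set.powersetCard.ofCard (Finset.card_singleton i)) (Set.powersetCard.ofCard (s := s) rfl)
  have h3 := ExteriorAlgebra.basis_mul_of_disjoint B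
    (Set.powersetCard.ofCard (Finset.card_singleton i)) (Set.powersetCard.ofCard (s := s) rfl)
  rw [h1]
  split_ifs with h
  · apply h2
    simpa [Set.powersetCard.ofCard] using h
  · have hd : Disjoint (Set.powersetCard.ofCard (Finset.card_singleton i)).val
      (Set.powersetCard.ofCard (s := s) rfl).val := by
      simpa [Set.powersetCard.ofCard] using h
    have h4 := h3 hd
    refine h4.trans ?_
    have h5 : B.ExteriorAlgebra (Set.powersetCard.disjUnion hd : Finset I)
        = B.ExteriorAlgebra (insert i s) := by
      congr 1
      ext j
      simp [Set.powersetCard.disjUnion, Set.powersetCard.ofCard]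
    rw [h5]
    rcases Int.units_eq_one_or (Equiv.Perm.sign (Set.powersetCard.permOfDisjoint hd)) with h | h
    · rw [h, one_smul]
    · rw [h, Units.neg_smul, one_smul, df_neg]

lemma E_eq_logForm (β : I → F)
    (hB : ∀ j, β j ≠ 0 ∧ B j = (β j)⁻¹ • KaehlerDifferential.D ℤ F (β j)) (s : Finset I) :
    ∃ x : Fin s.card → F, B.ExteriorAlgebra s = logForm F x := by
  refine ⟨fun k => β (s.orderEmbOfFin rfl k), ?_⟩
  rw [ExteriorAlgebra.basis_apply_ofCard B (n := s.card) rfl, ExteriorAlgebra.ιMulti_family,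
    ExteriorAlgebra.ιMulti_apply, logForm]
  congr 2
  funext k
  rw [dLog, ← (hB _).2]
  simp [Set.powersetCard.ofFinEmbEquiv_symm_apply, Set.powersetCard.ofCard]

lemma df_induction {P : DF F → Prop} (h0 : P 0) (hadd : ∀ x y, P x → P y → P (x + y))
    (hE : ∀ (a : F) (s : Finset I), P (a • B.ExteriorAlgebra s)) (w : DF F) : P w := by
  rw [← B.ExteriorAlgebra.linearCombination_repr w, Finsupp.linearCombination_apply, Finsupp.sum]
  exact Finset.sum_induction _ P hadd h0 fun s _ => hE _ s

lemma coef_mul (ξ : KaehlerDifferential ℤ F) (w : DF F) (γ : Finset I) :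
    B.ExteriorAlgebra.repr (ExteriorAlgebra.ι F ξ * w) γ
      = ∑ j ∈ γ, B.repr ξ j * B.ExteriorAlgebra.repr w (γ.erase j) := by
  induction w using df_induction B with
  | h0 => simp
  | hadd x y hx hy =>
    rw [mul_add, map_add, Finsupp.add_apply, hx, hy, ← Finset.sum_add_distrib]
    simp only [map_add, Finsupp.add_apply, mul_add]
  | hE a s =>
    have key : ∀ i, B.ExteriorAlgebra.repr (ExteriorAlgebra.ι F (B i) * B.ExteriorAlgebra s) γ
        = ∑ j ∈ γ, B.repr (B i) j * B.ExteriorAlgebra.repr (B.ExteriorAlgebra s) (γ.erase j) := by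
      intro i
      rw [iota_mul_E]
      have h1 : ∀ j ∈ γ, B.repr (B i) j * B.ExteriorAlgebra.repr (B.ExteriorAlgebra s) (γ.erase j)
          = if i = j then (if s = γ.erase i then 1 else 0) else 0 := by
        intro j _
        rw [Module.Basis.repr_self, Module.Basis.repr_self, Finsupp.single_apply,
          Finsupp.single_apply]
        by_cases h : i = j
        · subst h; simp
        · simp [h]
      rw [Finset.sum_congr rfl h1, Finset.sum_ite_eq]
      by_cases his : i ∈ s
      · rw [if_pos his]
        have : s ≠ γ.erase i := by rintro rfl; simp at his
        simp [this]
      · rw [if_neg his, Module.Basis.repr_self, Finsupp.single_apply]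
        by_cases h : insert i s = γ
        · subst h
          simp [Finset.erase_insert his]
        · rw [if_neg h]
          by_cases hi : i ∈ γ
          · have : s ≠ γ.erase i := by
              rintro rfl
              exact h (Finset.insert_erase hi)
            simp [this]
          · simp [hi]
    have h2 : B.ExteriorAlgebra.repr (ExteriorAlgebra.ι F ξ * B.ExteriorAlgebra s) γ
        = ∑ j ∈ γ, B.repr ξ j * B.ExteriorAlgebra.repr (B.ExteriorAlgebra s) (γ.erase j) := by
      have hξ : ξ ∈ Submodule.span F (Set.range B) := by rw [B.span_eq]; trivial
      induction hξ using Submodule.span_induction with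
      | mem x h => obtain ⟨i, rfl⟩ := h; exact key i
      | zero => simp
      | add x y _ _ hx hy =>
        rw [map_add, add_mul, map_add, Finsupp.add_apply, hx, hy, ← Finset.sum_add_distrib]
        simp only [map_add, Finsupp.add_apply, add_mul]
      | smul c x _ hx =>
        rw [map_smul, smul_mul_assoc, map_smul, Finsupp.smul_apply, hx, smul_eq_mul,
          Finset.mul_sum]
        simp only [map_smul, Finsupp.smul_apply, smul_eq_mul, mul_assoc]
    rw [mul_smul_comm, map_smul, Finsupp.smul_apply, h2, smul_eq_mul, Finset.mul_sum]
    refine Finset.sum_congr rfl fun j _ => ?_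
    rw [map_smul, Finsupp.smul_apply, smul_eq_mul]
    ring

lemma coef_card (n : ℕ) (w : DF F) (hw : w ∈ omegaPow F n) (γ : Finset I)
    (h : B.ExteriorAlgebra.repr w γ ≠ 0) : γ.card = n := by
  induction n generalizing w γ with
  | zero =>
    rw [omegaPow, pow_zero, Submodule.mem_one] at hw
    obtain ⟨a, rfl⟩ := hw
    have h1 : (algebraMap F (DF F) a) = a • B.ExteriorAlgebra ∅ := by
      rw [ExteriorAlgebra.basis_apply_ofCard B (n := 0) Finset.card_empty,
        Algebra.algebraMap_eq_smul_one]
      simp [ExteriorAlgebra.ιMulti_family, ExteriorAlgebra.ιMulti_apply]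
    rw [h1, map_smul, Module.Basis.repr_self, Finsupp.smul_apply, Finsupp.single_apply] at h
    by_cases h2 : ∅ = γ
    · rw [← h2]; rfl
    · simp [h2] at h
  | succ n ih =>
    rw [omegaPow, pow_succ'] at hw
    revert γ
    refine Submodule.mul_induction_on
      (C := fun w => ∀ γ, B.ExteriorAlgebra.repr w γ ≠ 0 → γ.card = n + 1) hw ?_ ?_
    · intro x hx y hy γ h
      obtain ⟨ξ, rfl⟩ := hx
      rw [coef_mul] at h
      obtain ⟨j, hj, hne⟩ := Finset.exists_ne_zero_of_sum_ne_zero h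
      have := ih y hy _ (right_ne_zero_of_mul hne)
      rw [Finset.card_erase_of_mem hj] at this
      have := Finset.card_pos.2 ⟨j, hj⟩
      omega
    · intro x y hx hy γ h
      by_cases h1 : B.ExteriorAlgebra.repr x γ = 0
      · apply hy
        rw [map_add, Finsupp.add_apply, h1, zero_add] at h
        exact h
      · exact hx _ h1

lemma E_empty : B.ExteriorAlgebra ∅ = (1 : DF F) := by
  rw [ExteriorAlgebra.basis_apply_ofCard B (n := 0) Finset.card_empty]
  simp [ExteriorAlgebra.ιMulti_family, ExteriorAlgebra.ιMulti_apply]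

variable (S : DiffStr 2 F) (β : I → F)

lemma coef_d
    (hB : ∀ j, β j ≠ 0 ∧ B j = (β j)⁻¹ • KaehlerDifferential.D ℤ F (β j))
    (w : DF F) (γ : Finset I) :
    B.ExteriorAlgebra.repr (S.d w) γ
      = ∑ j ∈ γ, pd B j (B.ExteriorAlgebra.repr w (γ.erase j)) := by
  induction w using df_induction B with
  | h0 => simp
  | hadd x y hx hy =>
    rw [map_add, map_add, Finsupp.add_apply, hx, hy, ← Finset.sum_add_distrib]
    simp only [map_add, Finsupp.add_apply]
  | hE a s =>
    obtain ⟨x, hx⟩ := E_eq_logForm B β hB s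
    have hd : S.d (B.ExteriorAlgebra s) = 0 := by rw [hx]; exact d_logForm S x
    rw [S.d_smul, hd, smul_zero, add_zero, dForm, coef_mul]
    refine Finset.sum_congr rfl fun j _ => ?_
    rw [map_smul, Finsupp.smul_apply, Module.Basis.repr_self, Finsupp.single_apply, pd_apply]
    split_ifs <;> simp

lemma coef_sp
    (hB : ∀ j, β j ≠ 0 ∧ B j = (β j)⁻¹ • KaehlerDifferential.D ℤ F (β j))
    (w : DF F) : ∃ η : DF F, ∀ γ, B.ExteriorAlgebra.repr (S.sp w) γ
      = (B.ExteriorAlgebra.repr w γ) ^ 2 + B.ExteriorAlgebra.repr (S.d η) γ := by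
  induction w using df_induction B with
  | h0 => exact ⟨0, by simp⟩
  | hadd x y hx hy =>
    obtain ⟨η, h⟩ := hx
    obtain ⟨η', h'⟩ := hy
    refine ⟨η + η', fun γ => ?_⟩
    simp only [map_add, Finsupp.add_apply, h, h', CharTwo.add_sq]
    ring
  | hE a s =>
    obtain ⟨x, hx⟩ := E_eq_logForm B β hB s
    obtain ⟨η, -, h⟩ := S.sp_log _ a x
    refine ⟨η, fun γ => ?_⟩
    rw [hx, h, ← hx, map_add, Finsupp.add_apply, map_smul, map_smul, Finsupp.smul_apply,
      Finsupp.smul_apply, Module.Basis.repr_self, Finsupp.single_apply]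
    split_ifs <;> simp

end FormPart

section KatoPart

open Finset.Colex

variable {F : Type*} [Field F] [CharP F 2]

/-- The logarithmic generators with first entry in `K`. -/
def genSet (K : Subfield F) : ℕ → Set (DF F)
  | 0 => {1}
  | n + 1 => { x | ∃ (u : F) (y : Fin n → F), u ∈ K ∧ u ≠ 0 ∧ (∀ i, y i ≠ 0) ∧
          x = dLog F u * logForm F y }

lemma dLog_mul_gen (K : Subfield F) (n : ℕ) (x : F) (hx : x ≠ 0) (hn : n = 0 → x ∈ K) (w : DF F)
    (hw : w ∈ AddSubgroup.closure (genSet K n)) :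
    dLog F x * w ∈ AddSubgroup.closure (genSet K (n + 1)) := by
  induction hw using AddSubgroup.closure_induction with
  | mem w hw =>
    apply AddSubgroup.subset_closure
    cases n with
    | zero =>
      have : w = 1 := hw
      subst this
      exact ⟨x, Fin.elim0, hn rfl, hx, fun i => i.elim0, by rw [logForm_zero]⟩
    | succ n =>
      obtain ⟨u, y, hu, hu0, hy, rfl⟩ := hw
      refine ⟨u, Fin.cons x y, hu, hu0, ?_, ?_⟩
      · intro i
        refine Fin.cases ?_ ?_ i
        · simpa using hx
        · simpa using hy
      · rw [logForm_cons, ← mul_assoc, ← mul_assoc]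
        congr 1
        exact iota_comm _ _
  | zero => simp
  | add a b _ _ ha hb => rw [mul_add]; exact add_mem ha hb
  | neg a _ ha => rw [mul_neg]; exact neg_mem ha

variable {I : Type*} [LinearOrder I]

lemma colex_aux1 {T γ : Finset I} {m j : I} (hT : ∀ x ∈ T, x < m) (h : γ.erase j = T)
    (hjm : j < m) : toColex γ < toColex (insert m T) := by
  rw [toColex_lt_toColex_iff_exists_forall_lt]
  subst h
  refine ⟨m, by simp, fun hm => ?_, fun b hb hb' => ?_⟩
  · exact lt_irrefl _ (hT m (Finset.mem_erase.2 ⟨hjm.ne', hm⟩))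
  · by_cases hbj : b = j
    · rw [hbj]; exact hjm
    · exact hT b (Finset.mem_erase.2 ⟨hbj, hb⟩)

lemma colex_aux2 {T γ : Finset I} {m j : I} (hT : ∀ x ∈ T, x < m)
    (h : toColex (γ.erase j) < toColex T) (hjm : j ≤ m) :
    toColex γ < toColex (insert m T) := by
  rw [toColex_lt_toColex_iff_exists_forall_lt] at h ⊢
  obtain ⟨a, haT, ha, hb⟩ := h
  rcases hjm.eq_or_lt with rfl | hjm
  · refine ⟨a, by simp [haT], fun h => ha (Finset.mem_erase.2 ⟨(hT a haT).ne, h⟩), ?_⟩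
    intro b hbγ hbT
    rw [Finset.mem_insert, not_or] at hbT
    exact hb b (Finset.mem_erase.2 ⟨hbT.1, hbγ⟩) hbT.2
  · refine ⟨m, by simp, fun hm => ?_, ?_⟩
    · have := hb m (Finset.mem_erase.2 ⟨hjm.ne', hm⟩) fun h => lt_irrefl _ (hT m h)
      exact lt_asymm this (hT a haT)
    · intro b hbγ hbT
      by_cases hbj : b = j
      · rw [hbj]; exact hjm
      · rw [Finset.mem_insert, not_or] at hbT
        exact (hb b (Finset.mem_erase.2 ⟨hbj, hbγ⟩) hbT.2).trans (hT a haT)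

lemma colex_aux3 {α : Finset I} {i j : I} (hi : i ∉ α) (hji : j < i) :
    toColex α < toColex ((insert i α).erase j) := by
  rw [toColex_lt_toColex_iff_exists_forall_lt]
  refine ⟨i, by simp [hji.ne'], hi, fun b hb hb' => ?_⟩
  have : b = j := by
    by_contra h
    exact hb' (by simp [h, hb])
  rw [this]; exact hji

lemma colex_wf [WellFoundedLT I] : WellFounded (fun s t : Finset I => toColex s < toColex t) := by
  classical
  have h := Finsupp.Lex.wellFounded' (α := I) (N := ℕ) (r := fun a b => b < a)
    (s := fun a b => a < b) (fun n => Nat.not_lt_zero n) Nat.lt_wfRel.wf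
    (hr := (wellFounded_lt : WellFounded ((· < ·) : I → I → Prop)))
  refine Subrelation.wf ?_ (InvImage.wf (fun s : Finset I => Finsupp.indicator s fun _ _ => 1) h)
  intro s t hst
  rw [lt_iff_exists_filter_lt] at hst
  obtain ⟨w, hw, hf⟩ := hst
  rw [Finset.mem_sdiff] at hw
  refine ⟨w, ?_, ?_⟩
  · intro j hj
    have : j ∈ s ↔ j ∈ t := by
      have := Finset.ext_iff.1 hf j
      simpa [hj] using this
    simp [Finsupp.indicator_apply, this]
  · simp [Finsupp.indicator_apply, hw]

variable (B : Module.Basis I F (KaehlerDifferential ℤ F)) (S : DiffStr 2 F) (β : I → F)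

lemma topSum_of_closed
    (hB : ∀ j, β j ≠ 0 ∧ B j = (β j)⁻¹ • KaehlerDifferential.D ℤ F (β j))
    (z : DF F) (α : Finset I)
    (hlead : ∀ γ, toColex α < toColex γ → B.ExteriorAlgebra.repr (S.d z) γ = 0) :
    TopSum B α (B.ExteriorAlgebra.repr (S.d z) α) := by
  set y := fun γ => B.ExteriorAlgebra.repr (S.d z) γ with hy
  set c := y α with hc
  have hclosed : ∀ γ : Finset I, ∑ j ∈ γ, pd B j (y (γ.erase j)) = 0 := by
    intro γ
    rw [← coef_d B S β hB, S.d_d]; simp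
  have hcα : c = ∑ j ∈ α, pd B j (B.ExteriorAlgebra.repr z (α.erase j)) := coef_d B S β hB z α
  obtain ⟨c0, f, h1, h2, h3⟩ := exists_decomp B β hB (B.repr (KaehlerDifferential.D ℤ F c)).support c
    (fun i hi => by rw [pd_apply]; simpa using hi)
  set T := (B.repr (KaehlerDifferential.D ℤ F c)).support
  have hc0 : c0 = 0 := by
    refine sum_pd_eq_zero B β hB (T ∪ α) c0 (fun j =>
      (if j ∈ α then B.ExteriorAlgebra.repr z (α.erase j) else 0) - (if j ∈ T then f j else 0))
      ?_ (fun j _ => h2 j)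
    simp only [map_sub, Finset.sum_sub_distrib, apply_ite (pd B _), map_zero]
    rw [Finset.sum_ite_mem, Finset.sum_ite_mem, Finset.union_inter_cancel_right,
      Finset.union_inter_cancel_left, ← hcα, Finset.sum_congr rfl fun i hi => (h3 i hi).1, h1]
    ring
  have hf0 : ∀ i ∈ T, i ∉ α → f i = 0 := by
    intro i hiT hiα
    have e1 := hclosed (insert i α)
    rw [Finset.sum_insert hiα, Finset.erase_insert hiα] at e1
    have e2 : ∑ j ∈ α, pd B j (y ((insert i α).erase j))
        = ∑ j ∈ α.filter (i < ·), pd B j (y ((insert i α).erase j)) := by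
      rw [Finset.sum_filter]
      refine Finset.sum_congr rfl fun j hj => ?_
      split_ifs with hij
      · rfl
      · have hji : j < i := lt_of_le_of_ne (not_lt.1 hij) (fun h => hiα (h ▸ hj))
        have : y ((insert i α).erase j) = 0 := hlead _ (colex_aux3 hiα hji)
        rw [this, map_zero]
    have e3 : pd B i c = f i + ∑ k ∈ T.filter (i < ·), pd B k (pd B i (f k)) := by
      rw [h1, hc0, zero_add, map_sum, Finset.sum_filter, ← Finset.add_sum_erase _ _ hiT,
        ← Finset.add_sum_erase _ _ hiT, (h3 i hiT).1, if_neg (lt_irrefl i), zero_add]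
      congr 1
      refine Finset.sum_congr rfl fun k hk => ?_
      have hkT := Finset.mem_of_mem_erase hk
      split_ifs with hik
      · rw [pd_comm B β hB, (h3 k hkT).1]
      · exact (h3 k hkT).2 i (lt_of_le_of_ne (not_lt.1 hik) (Finset.ne_of_mem_erase hk))
    refine sum_pd_eq_zero B β hB ((T ∪ α).filter (i < ·)) (f i) (fun j =>
      -(if j ∈ α then y ((insert i α).erase j) else 0) - (if j ∈ T then pd B i (f j) else 0))
      ?_ (fun j hj => (h3 i hiT).2 j (Finset.mem_filter.1 hj).2)
    simp only [map_sub, map_neg, Finset.sum_sub_distrib, Finset.sum_neg_distrib,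
      apply_ite (pd B _), map_zero]
    rw [Finset.sum_ite_mem, Finset.sum_ite_mem, Finset.filter_inter, Finset.filter_inter]
    rw [Finset.union_inter_cancel_right, Finset.union_inter_cancel_left]
    rw [e2, e3] at e1
    linear_combination e1
  refine ⟨fun i => if i ∈ T then f i else 0, ?_, ?_⟩
  · show c = ∑ i ∈ α, if i ∈ T then f i else 0
    rw [h1, hc0, zero_add, Finset.sum_ite_mem]
    symm
    refine Finset.sum_subset Finset.inter_subset_right fun i hi hi' => hf0 i hi fun h => hi' ?_
    exact Finset.mem_inter.2 ⟨h, hi⟩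
  · intro i _
    by_cases hi : i ∈ T
    · simpa [hi] using h3 i hi
    · simp [hi]

lemma topSum_sq
    (hB : ∀ j, β j ≠ 0 ∧ B j = (β j)⁻¹ • KaehlerDifferential.D ℤ F (β j))
    (α : Finset I) (a : F) (h : TopSum B α (a ^ 2)) : a = 0 := by
  obtain ⟨f, h1, h2⟩ := h
  have := sum_pd_eq_zero B β hB α (a ^ 2) f
    (by rw [h1]; exact Finset.sum_congr rfl fun i hi => ((h2 i hi).1).symm)
    (fun j _ => der_sq _ _)
  exact pow_eq_zero_iff two_ne_zero |>.1 this

lemma kato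
    (hB : ∀ j, β j ≠ 0 ∧ B j = (β j)⁻¹ • KaehlerDifferential.D ℤ F (β j))
    (Low : Set I) (hLow : ∀ i j, i < j → j ∈ Low → i ∈ Low) (K : Subfield F)
    (hK : ∀ u, (∀ j, j ∉ Low → pd B j u = 0) → u ∈ K) (α : Finset I) :
    ∀ a : F, (α.Nonempty → ∃ i ∈ α, i ∈ Low) → TopSum B α (a ^ 2 + a) →
      ∃ θ ∈ AddSubgroup.closure (genSet K α.card),
        ∀ γ, B.ExteriorAlgebra.repr (a • B.ExteriorAlgebra α - θ) γ ≠ 0 →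
          toColex γ < toColex α := by
  have two0 : (2 : F) = 0 := CharTwo.two_eq_zero
  induction α using Finset.induction_on_max with
  | empty =>
    rintro a - ⟨f, h1, -⟩
    rw [Finset.sum_empty] at h1
    have h2 : a * (a + 1) = 0 := by linear_combination h1
    rcases mul_eq_zero.1 h2 with h | h
    · exact ⟨0, zero_mem _, by simp [h]⟩
    · have ha : a = 1 := by linear_combination h - two0
      refine ⟨1, AddSubgroup.subset_closure rfl, ?_⟩
      rw [ha, E_empty]; simp
  | insert m T hm ih =>
    rintro a hne ⟨f, h1, h2⟩
    have hmT : m ∉ T := fun h => lt_irrefl _ (hm m h)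
    by_cases ha : a = 0
    · exact ⟨0, zero_mem _, by simp [ha]⟩
    have hpda : ∀ j, pd B j a = pd B j (∑ i ∈ insert m T, f i) := by
      intro j
      rw [← h1, map_add, der_sq, zero_add]
    have hja : ∀ j, m < j → pd B j a = 0 := by
      intro j hj
      rw [hpda, map_sum]
      refine Finset.sum_eq_zero fun i hi => (h2 i hi).2 j ?_
      rcases Finset.mem_insert.1 hi with rfl | hi
      · exact hj
      · exact (hm i hi).trans hj
    rw [Finset.sum_insert hmT] at h1 hpda
    have hma : pd B m a = f m := by
      rw [hpda, map_add, map_sum, Finset.sum_eq_zero, add_zero]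
      · exact (h2 m (Finset.mem_insert_self _ _)).1
      · intro i hi
        exact (h2 i (Finset.mem_insert_of_mem hi)).2 m (hm i hi)
    set h := f m with hh
    set R := ∑ i ∈ T, f i with hR
    set g := a + h with hg
    have hgR : g + a ^ 2 = R := by
      rw [hg]; linear_combination h1 + h * two0
    have hTR : ∀ u : F, TopSum B T (u ^ 2 * R) := by
      intro u
      refine ⟨fun i => u ^ 2 * f i, by rw [hR, Finset.mul_sum], fun i hi => ?_⟩
      have := h2 i (Finset.mem_insert_of_mem hi)
      refine ⟨by rw [der_sq_mul, this.1], fun j hj => by rw [der_sq_mul, this.2 j hj, mul_zero]⟩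
    have hg0 : g ≠ 0 := by
      intro hg0
      rw [hg0, zero_add] at hgR
      apply ha
      apply topSum_sq B β hB T a
      have := hTR 1
      rwa [one_pow, one_mul, ← hgR] at this
    have hc' : (a ^ 2 / g) ^ 2 + a ^ 2 / g = (a / g) ^ 2 * R := by
      rw [← hgR]; field_simp; ring
    obtain ⟨θ', hθ', hlow'⟩ := ih (a ^ 2 / g) (by
      rintro ⟨i, hi⟩
      obtain ⟨k, hk, hkL⟩ := hne ⟨m, Finset.mem_insert_self _ _⟩
      rcases Finset.mem_insert.1 hk with rfl | hk
      · exact ⟨i, hi, hLow i k (hm i hi) hkL⟩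
      · exact ⟨k, hk, hkL⟩) (hc' ▸ hTR _)
    obtain ⟨x, hx0, hxm, hxj⟩ : ∃ x : F, x ≠ 0 ∧ a * pd B m x = g * x ∧
        ∀ j, m < j → pd B j x = 0 := by
      by_cases hh0 : h = 0
      · refine ⟨β m, (hB m).1, ?_, fun j hj => ?_⟩
        · rw [pd_beta B β hB, if_pos rfl, hg, hh0, add_zero]
        · rw [pd_beta B β hB, if_neg hj.ne']
      · have hmh : pd B m h = h := (h2 m (Finset.mem_insert_self _ _)).1
        refine ⟨h * a, mul_ne_zero hh0 ha, ?_, fun j hj => ?_⟩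
        · rw [Derivation.leibniz, hma, hmh, smul_eq_mul, smul_eq_mul, hg]; ring
        · rw [Derivation.leibniz, hja j hj,
            (h2 m (Finset.mem_insert_self _ _)).2 j hj]; simp
    rw [Finset.card_insert_of_notMem hmT]
    refine ⟨dLog F x * θ', dLog_mul_gen K _ x hx0 ?_ _ hθ', ?_⟩
    · intro hT0
      rw [Finset.card_eq_zero] at hT0
      subst hT0
      obtain ⟨k, hk, hkL⟩ := hne ⟨m, Finset.mem_insert_self _ _⟩
      have hkm : k = m := by simpa using hk
      subst hkm
      apply hK
      intro j hj
      apply hxj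
      by_contra hjk
      rcases (not_lt.1 hjk).eq_or_lt with rfl | hlt
      · exact hj hkL
      · exact hj (hLow j k hlt hkL)
    · intro γ hγ
      have hrep : ∀ j, B.repr (x⁻¹ • KaehlerDifferential.D ℤ F x) j = x⁻¹ * pd B j x := by
        intro j; rw [map_smul, Finsupp.smul_apply, smul_eq_mul, pd_apply]
      have hjm : ∀ j, x⁻¹ * pd B j x ≠ 0 → j ≤ m := by
        intro j hj
        by_contra hjm
        rw [hxj j (not_le.1 hjm)] at hj
        simp at hj
      have hsplit : a • B.ExteriorAlgebra (insert m T) - dLog F x * θ'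
          = (a • B.ExteriorAlgebra (insert m T)
              - dLog F x * ((a ^ 2 / g) • B.ExteriorAlgebra T))
            + dLog F x * ((a ^ 2 / g) • B.ExteriorAlgebra T - θ') := by
        rw [mul_sub]; abel
      rw [hsplit, map_add, Finsupp.add_apply] at hγ
      by_cases h0 : B.ExteriorAlgebra.repr
          (dLog F x * ((a ^ 2 / g) • B.ExteriorAlgebra T - θ')) γ = 0
      · rw [h0, add_zero, map_sub, Finsupp.sub_apply, map_smul, Finsupp.smul_apply,
          Module.Basis.repr_self, dLog, coef_mul] at hγ
        simp only [map_smul, Finsupp.smul_apply, Module.Basis.repr_self,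
          Finsupp.single_apply, smul_eq_mul] at hγ
        by_cases hγα : insert m T = γ
        · exfalso
          apply hγ
          subst hγα
          rw [if_pos rfl, Finset.sum_insert hmT, Finset.erase_insert hmT, if_pos rfl,
            Finset.sum_eq_zero, add_zero, mul_one, mul_one]
          · have : B.repr (KaehlerDifferential.D ℤ F x) m = g * x / a := by
              rw [← pd_apply]; field_simp; linear_combination hxm
            rw [this]; field_simp; ring
          · intro j hj
            rw [if_neg, mul_zero, mul_zero]
            intro hT
            have : j ∈ (insert m T).erase j := by rw [← hT]; exact hj
            simp at this
        · rw [if_neg hγα, mul_zero, zero_sub, neg_ne_zero] at hγ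
          obtain ⟨j, hj, hne⟩ := Finset.exists_ne_zero_of_sum_ne_zero hγ
          have hjm' := hjm j (left_ne_zero_of_mul hne)
          have hT : T = γ.erase j := by
            by_contra hT
            rw [if_neg hT] at hne
            simp at hne
          refine colex_aux1 hm hT.symm (lt_of_le_of_ne hjm' ?_)
          rintro rfl
          apply hγα
          rw [hT, Finset.insert_erase hj]
      · rw [dLog, coef_mul] at h0
        obtain ⟨j, hj, hne⟩ := Finset.exists_ne_zero_of_sum_ne_zero h0
        rw [hrep] at hne
        exact colex_aux2 hm (hlow' _ (right_ne_zero_of_mul hne))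
          (hjm j (left_ne_zero_of_mul hne))

end KatoPart

section FinalPart

open Finset.Colex

variable {F : Type*} [Field F] [CharP F 2]

/-- The left hand side of the theorem. -/
def InLHS (S : DiffStr 2 F) {r : ℕ} (b : Fin r → F) (n : ℕ) (ω : DF F) : Prop :=
  (∃ η : Fin r → DF F, (∀ i, η i ∈ omegaPow F n) ∧
        ω = ∑ i, dForm F (b i) * η i) ∧ ω ∈ nuSet S (n + 1)

lemma InLHS.sub {S : DiffStr 2 F} {r : ℕ} {b : Fin r → F} {n : ℕ} {ω ω' : DF F}
    (h : InLHS S b n ω) (h' : InLHS S b n ω') : InLHS S b n (ω - ω') := by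
  obtain ⟨⟨η, h1, h2⟩, h3, z, h4, h5⟩ := h
  obtain ⟨⟨η', h1', h2'⟩, h3', z', h4', h5'⟩ := h'
  refine ⟨⟨fun i => η i - η' i, fun i => sub_mem (h1 i) (h1' i), ?_⟩, sub_mem h3 h3',
    z - z', sub_mem h4 h4', ?_⟩
  · rw [h2, h2', ← Finset.sum_sub_distrib]
    exact Finset.sum_congr rfl fun i _ => (mul_sub _ _ _).symm
  · rw [map_sub, map_sub, ← h5, ← h5']; abel

lemma InLHS.zero (S : DiffStr 2 F) {r : ℕ} (b : Fin r → F) (n : ℕ) : InLHS S b n 0 :=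
  ⟨⟨0, fun _ => zero_mem _, by simp⟩, zero_mem _, 0, zero_mem _, by simp⟩

lemma D_mem_span {r : ℕ} (b : Fin r → F) (u : F) (hu : u ∈ sqSubfield b) :
    KaehlerDifferential.D ℤ F u ∈
      Submodule.span F (Set.range fun i => KaehlerDifferential.D ℤ F (b i)) := by
  induction hu using Subfield.closure_induction with
  | mem x hx =>
    rcases hx with ⟨y, rfl⟩ | ⟨i, rfl⟩
    · have : KaehlerDifferential.D ℤ F (y ^ 2) = 0 := by
        have h2 : (2 : F) = 0 := CharTwo.two_eq_zero
        rw [pow_two, Derivation.leibniz, ← two_smul F, h2, zero_smul]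
      show KaehlerDifferential.D ℤ F (y ^ 2) ∈ _
      rw [this]; exact zero_mem _
    · exact Submodule.subset_span ⟨i, rfl⟩
  | one => rw [Derivation.map_one_eq_zero]; exact zero_mem _
  | add x y _ _ hx hy => rw [map_add]; exact add_mem hx hy
  | neg x _ hx => rw [map_neg]; exact neg_mem hx
  | inv x _ hx => rw [Derivation.leibniz_inv]; exact Submodule.smul_mem _ _ hx
  | mul x y _ _ hx hy =>
    rw [Derivation.leibniz]
    exact add_mem (Submodule.smul_mem _ _ hy) (Submodule.smul_mem _ _ hx)

lemma gen_inLHS (S : DiffStr 2 F) {r : ℕ} (b : Fin r → F) (n : ℕ) (ω : DF F)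
    (hω : ω ∈ AddSubgroup.closure (genSet (sqSubfield b) (n + 1))) : InLHS S b n ω := by
  induction hω using AddSubgroup.closure_induction with
  | mem w hw =>
    obtain ⟨u, y, hu, hu0, hy, rfl⟩ := hw
    refine ⟨?_, ?_⟩
    · obtain ⟨c, hc⟩ := (Submodule.mem_span_range_iff_exists_fun F).1 (D_mem_span b u hu)
      refine ⟨fun i => (u⁻¹ * c i) • logForm F y,
        fun i => Submodule.smul_mem _ _ (logForm_mem y), ?_⟩
      rw [dLog_eq, dForm, ← hc, map_sum, Finset.smul_sum, Finset.sum_mul]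
      refine Finset.sum_congr rfl fun i _ => ?_
      rw [map_smul, smul_smul, smul_mul_assoc, mul_smul_comm, dForm]
    · rw [← logForm_cons]
      refine ⟨logForm_mem _, ?_⟩
      obtain ⟨η, h1, h2⟩ := S.sp_log (n + 1) 1 (Fin.cons u y)
      refine ⟨η, h1, ?_⟩
      rw [one_smul, one_pow, one_smul] at h2
      rw [h2]; abel
  | zero => exact InLHS.zero S b n
  | add x y _ _ hx hy =>
    have := hx.sub hy
    rwa [sub_eq_add_neg, df_neg] at this
  | neg x _ hx => rwa [df_neg]

lemma exists_order {J : Type*} (Low : Set J) : ∃ _ : LinearOrder J, WellFoundedLT J ∧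
    ∀ i j : J, i < j → j ∈ Low → i ∈ Low := by
  classical
  let f : J → ℕ ×ₗ Ordinal := fun j =>
    toLex ((if j ∈ Low then 0 else 1 : ℕ), Ordinal.typein (WellOrderingRel (α := J)) j)
  have hf : Function.Injective f := by
    intro i j h
    have h2 : Ordinal.typein (WellOrderingRel (α := J)) i = Ordinal.typein WellOrderingRel j :=
      congrArg (fun x => (ofLex x).2) h
    exact Ordinal.typein_injective _ h2
  let L : LinearOrder J := LinearOrder.lift' f hf
  refine ⟨L, ⟨?_⟩, ?_⟩
  · exact InvImage.wf f (wellFounded_lt : WellFounded ((· < ·) : ℕ ×ₗ Ordinal → _ → Prop))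
  · intro i j hij hj
    have hij' : f i < f j := hij
    by_contra hi
    rw [Prod.Lex.lt_iff] at hij'
    simp [f, hi, hj] at hij'

lemma main_aux {I : Type*} [LinearOrder I] [WellFoundedLT I]
    (B : Module.Basis I F (KaehlerDifferential ℤ F)) (S : DiffStr 2 F) (β : I → F)
    (hB : ∀ j, β j ≠ 0 ∧ B j = (β j)⁻¹ • KaehlerDifferential.D ℤ F (β j))
    {r : ℕ} (b : Fin r → F) (n : ℕ) (hb : ∀ i, ∃ j, β j = b i)
    (hLow : ∀ i j : I, i < j → β j ∈ Set.range b → β i ∈ Set.range b)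
    (hK : ∀ u, (∀ j, β j ∉ Set.range b → pd B j u = 0) → u ∈ sqSubfield b)
    (α : Finset I) : ∀ ω : DF F, InLHS S b n ω →
      (∀ γ, B.ExteriorAlgebra.repr ω γ ≠ 0 → toColex γ ≤ toColex α) →
      ω ∈ AddSubgroup.closure (genSet (sqSubfield b) (n + 1)) := by
  induction α using (colex_wf (I := I)).induction with
  | _ α ih =>
  intro ω hω hsupp
  have next : ∀ ω' : DF F, InLHS S b n ω' →
      (∀ γ, B.ExteriorAlgebra.repr ω' γ ≠ 0 → toColex γ < toColex α) →
      ω' ∈ AddSubgroup.closure (genSet (sqSubfield b) (n + 1)) := by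
    intro ω' hω' hlt
    by_cases h0 : ω' = 0
    · rw [h0]; exact zero_mem _
    have hne : (B.ExteriorAlgebra.repr ω').support.Nonempty := by
      rw [Finsupp.support_nonempty_iff]
      simpa using h0
    obtain ⟨δ, hδ, hmax⟩ := Finset.exists_max_image _ (fun γ : Finset I => toColex γ) hne
    exact ih δ (hlt δ (Finsupp.mem_support_iff.1 hδ)) ω' hω'
      fun γ hγ => hmax γ (Finsupp.mem_support_iff.2 hγ)
  set a := B.ExteriorAlgebra.repr ω α with ha
  by_cases ha0 : a = 0
  · refine next ω hω fun γ hγ => lt_of_le_of_ne (hsupp γ hγ) ?_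
    intro h
    have : γ = α := toColex_inj.1 h
    exact hγ (this ▸ ha0)
  have hcard : α.card = n + 1 := coef_card B (n + 1) ω hω.2.1 α ha0
  have hmem : ∃ i ∈ α, i ∈ {j : I | β j ∈ Set.range b} := by
    obtain ⟨η, -, h2⟩ := hω.1
    rw [ha, h2, map_sum, Finsupp.finsetSum_apply] at ha0
    obtain ⟨i, -, hi⟩ := Finset.exists_ne_zero_of_sum_ne_zero ha0
    rw [dForm, coef_mul] at hi
    obtain ⟨j, hj, hne⟩ := Finset.exists_ne_zero_of_sum_ne_zero hi
    have h3 := left_ne_zero_of_mul hne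
    obtain ⟨k, hk⟩ := hb i
    rw [← hk, ← pd_apply, pd_beta B β hB] at h3
    have hjk : j = k := by
      by_contra h
      rw [if_neg h] at h3; exact h3 rfl
    exact ⟨j, hj, i, by rw [hjk, hk]⟩
  obtain ⟨-, z, -, hz⟩ := hω.2
  obtain ⟨η, hη⟩ := coef_sp B S β hB ω
  have hkey : ∀ γ, B.ExteriorAlgebra.repr (S.d (z - η)) γ
      = B.ExteriorAlgebra.repr ω γ ^ 2 + B.ExteriorAlgebra.repr ω γ := by
    intro γ
    have h2 : (2 : F) = 0 := CharTwo.two_eq_zero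
    rw [map_sub, ← hz, map_sub, map_sub, Finsupp.sub_apply, Finsupp.sub_apply, hη]
    linear_combination (- B.ExteriorAlgebra.repr ω γ) * h2
  have htop := topSum_of_closed B S β hB (z - η) α (by
    intro γ hγ
    have : B.ExteriorAlgebra.repr ω γ = 0 := by
      by_contra h
      exact absurd hγ (not_lt.2 (hsupp γ h))
    rw [hkey, this]; simp)
  rw [hkey] at htop
  obtain ⟨θ, hθ, hlt⟩ := kato B β hB {j : I | β j ∈ Set.range b} hLow (sqSubfield b) hK α a
    (fun _ => hmem) htop
  rw [hcard] at hθ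
  have hfin := next (ω - θ) (hω.sub (gen_inLHS S b n θ hθ)) (by
    intro γ hγ
    by_cases h0 : B.ExteriorAlgebra.repr (a • B.ExteriorAlgebra α - θ) γ = 0
    · have hs : ω - θ = (ω - a • B.ExteriorAlgebra α) + (a • B.ExteriorAlgebra α - θ) := by abel
      rw [hs, map_add, Finsupp.add_apply, h0, add_zero, map_sub, Finsupp.sub_apply, map_smul,
        Finsupp.smul_apply, Module.Basis.repr_self] at hγ
      by_cases hγα : γ = α
      · subst hγα
        simp [ha] at hγ
      · rw [Finsupp.single_eq_of_ne hγα, smul_zero, sub_zero] at hγ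
        exact lt_of_le_of_ne (hsupp γ hγ) fun h => hγα (toColex_inj.1 h)
    · exact hlt γ h0)
  have := add_mem hfin hθ
  rwa [sub_add_cancel] at this

lemma main_forward (S : DiffStr 2 F) {r : ℕ} (b : Fin r → F) (hb : TwoIndep b) (n : ℕ) (ω : DF F)
    (hω : InLHS S b n ω) : ω ∈ AddSubgroup.closure (genSet (sqSubfield b) (n + 1)) := by
  obtain ⟨J, B, hB, hbJ, hK⟩ := exists_good_basis b hb
  obtain ⟨L, hwf, hLow⟩ := exists_order {j : J | (j : F) ∈ Set.range b}
  by_cases h0 : ω = 0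
  · rw [h0]; exact zero_mem _
  have hne : (B.ExteriorAlgebra.repr ω).support.Nonempty := by
    rw [Finsupp.support_nonempty_iff]
    simpa using h0
  obtain ⟨δ, hδ, hmax⟩ := Finset.exists_max_image _ (fun γ : Finset J => toColex γ) hne
  exact main_aux B S (fun j : J => (j : F)) hB b n (fun i => ⟨⟨b i, hbJ ⟨i, rfl⟩⟩, rfl⟩)
    hLow hK δ ω hω fun γ hγ => hmax γ (Finsupp.mem_support_iff.2 hγ)

end FinalPart

/-- **Lemma 635.** Let `F` have characteristic 2 and let `b₁,…,b_r ∈ F` be 2-independent.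
Then `(Σᵢ dbᵢ ∧ Ω_F^{n-1}) ∩ ν_n(F) = ⟨dx/x : x ∈ F²(b₁,…,b_r)^*⟩ ∧ ν_{n-1}(F)`, i.e.
(below: degree `n+1`) this intersection is additively generated by the forms
`(dx/x)∧(dy₂/y₂)∧…∧(dyₙ/yₙ)` with `x ∈ F²(b₁,…,b_r)^*` and `y₂,…,yₙ ∈ F^*`. -/
theorem wedge_inter_nu_eq
    (F : Type*) [Field F] [CharP F 2] (S : DiffStr 2 F)
    (r : ℕ) (b : Fin r → F) (hb : TwoIndep b)
    (n : ℕ) (ω : DF F) :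
    ((∃ η : Fin r → DF F, (∀ i, η i ∈ omegaPow F n) ∧
        ω = ∑ i, dForm F (b i) * η i) ∧ ω ∈ nuSet S (n + 1)) ↔
    ω ∈ AddSubgroup.closure
      { x | ∃ (u : F) (y : Fin n → F), u ∈ sqSubfield b ∧ u ≠ 0 ∧ (∀ i, y i ≠ 0) ∧
          x = dLog F u * logForm F y } := by
  exact ⟨fun h => main_forward S b hb n ω h, fun h => gen_inLHS S b n ω h⟩
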